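/- Let (L(t)) be a C0-semigroup on H with generator A and ‖L(t)‖ ≤ M e^{λ₀ t} (M ≥ 1, λ₀ > 0), and let g : [0,∞) → H be weakly continuous with g(0) = 0, g(t+s) = L(t)g(s) + g(t) for all s,t ≥ 0, and ‖g(t)‖ ≤ C e^{λ₀ t}. Fix λ > λ₀ and set b_H := λ ∫₀^∞ e^{−λ t} g(t) dt ∈ H. Then for every t ≥ 0 the vector x_t := ∫₀ᵗ L(s) b_H ds belongs to dom(A) and g(t) = λ x_t − A x_t. -/

import Mathlib

open Set Filter
open scoped InnerProductSpace

open MeasureTheory intervalIntegral in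
/-- The primitive of an orbit of a strongly continuous semigroup lies in the domain of the
generator `A`, with `A ∫₀ᵗ L(s)b ds = L(t)b - b`. -/
theorem hasDerivWithinAt_semigroup_integral_orbit
    {E : Type*} [NormedAddCommGroup E] [NormedSpace ℝ E] [CompleteSpace E]
    {L : ℝ → E →L[ℝ] E} (hL0 : L 0 = ContinuousLinearMap.id ℝ E)
    (hLsem : ∀ s ≥ (0:ℝ), ∀ t ≥ (0:ℝ), L (s + t) = (L s).comp (L t))
    (hLcont : ∀ x : E, ContinuousOn (fun t => L t x) (Ici 0))
    (b : E) {t : ℝ} (ht : 0 ≤ t) :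
    HasDerivWithinAt (fun τ => L τ (∫ s in (0:ℝ)..t, L s b)) (L t b - b) (Ici 0) 0 := by
  -- extend the orbit continuously to negative times
  set f : ℝ → E := fun s => L (max s 0) b with hf_def
  have hf : Continuous f :=
    (hLcont b).comp_continuous (by fun_prop) (fun s => le_max_right s 0)
  have hf_nonneg : ∀ s, 0 ≤ s → f s = L s b := fun s hs => by simp [hf_def, max_eq_left hs]
  have hF : ∀ r, HasDerivAt (fun u => ∫ s in (0:ℝ)..u, f s) (f r) r := fun r =>
    (hf.integral_hasStrictDerivAt 0 r).hasDerivAt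
  have hderiv : HasDerivAt
      (fun τ => (∫ s in (0:ℝ)..(t + τ), f s) - ∫ s in (0:ℝ)..τ, f s) (L t b - b) 0 := by
    have h1 : HasDerivAt (fun τ => ∫ s in (0:ℝ)..(t + τ), f s) (f (t + 0)) 0 :=
      (hF (t + 0)).comp_const_add t 0
    have h2 := h1.sub (hF 0)
    rw [add_zero, hf_nonneg t ht, hf_nonneg 0 le_rfl, hL0] at h2
    exact h2
  have hshift : ∀ τ ∈ Ici (0:ℝ), L τ (∫ s in (0:ℝ)..t, L s b) =
      (∫ s in (0:ℝ)..(t + τ), f s) - ∫ s in (0:ℝ)..τ, f s := by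
    intro τ hτ
    have hcongr : ∫ s in (0:ℝ)..t, L s b = ∫ s in (0:ℝ)..t, f s := by
      refine integral_congr fun s hs => (hf_nonneg s ?_).symm
      rw [uIcc_of_le ht] at hs
      exact hs.1
    rw [hcongr, ← (L τ).intervalIntegral_comp_comm (hf.intervalIntegrable 0 t),
      integral_interval_sub_left (hf.intervalIntegrable _ _) (hf.intervalIntegrable _ _)]
    have hsemi : ∫ s in (0:ℝ)..t, L τ (f s) = ∫ s in (0:ℝ)..t, f (s + τ) := by
      refine integral_congr fun s hs => ?_
      rw [uIcc_of_le ht] at hs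
      have hτ' : 0 ≤ τ := hτ
      simp only [hf_nonneg s hs.1, hf_nonneg (s + τ) (add_nonneg hs.1 hτ')]
      rw [add_comm s τ, hLsem τ hτ s hs.1, ContinuousLinearMap.comp_apply]
    rw [hsemi, integral_comp_add_right, zero_add]
  exact hderiv.hasDerivWithinAt.congr_of_mem hshift self_mem_Ici

/-- An orthonormal family in a separable inner product space is countable. -/
theorem Orthonormal.countable_of_separableSpace
    {E : Type*} [NormedAddCommGroup E] [InnerProductSpace ℝ E]
    [TopologicalSpace.SeparableSpace E] {ι : Type*} {v : ι → E} (hv : Orthonormal ℝ v) :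
    Countable ι := by
  rw [← countable_univ_iff]
  refine PairwiseDisjoint.countable_of_isOpen (s := fun i => Metric.ball (v i) (1 / 2)) ?_
    (fun _ _ => Metric.isOpen_ball)
    (fun i _ => ⟨v i, Metric.mem_ball_self (by norm_num)⟩)
  intro i _ j _ hij
  refine Metric.ball_disjoint_ball ?_
  have hsq : ‖v i - v j‖ ^ 2 = 2 := by
    rw [norm_sub_sq_real, hv.1 i, hv.1 j, hv.2 hij]
    norm_num
  rw [dist_eq_norm]
  nlinarith [norm_nonneg (v i - v j)]

open MeasureTheory in
/-- Pettis measurability theorem in a separable Hilbert space. -/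
theorem stronglyMeasurable_of_inner
    {E : Type*} [NormedAddCommGroup E] [InnerProductSpace ℝ E] [CompleteSpace E]
    [TopologicalSpace.SeparableSpace E] {α : Type*} [MeasurableSpace α] {f : α → E}
    (hf : ∀ h : E, StronglyMeasurable fun a => ⟪f a, h⟫_ℝ) : StronglyMeasurable f := by
  obtain ⟨w, e, -⟩ := exists_hilbertBasis ℝ E
  have : Countable w := e.orthonormal.countable_of_separableSpace
  refine stronglyMeasurable_of_tendsto (atTop : Filter (Finset w))
    (f := fun s a => ∑ i ∈ s, ⟪f a, e i⟫_ℝ • e i) (fun s => ?_) ?_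
  · exact Finset.stronglyMeasurable_fun_sum s fun i _ => (hf (e i)).smul_const (e i)
  · refine tendsto_pi_nhds.2 fun a => ?_
    have h := e.hasSum_repr (f a)
    simp only [e.repr_apply_apply, real_inner_comm] at h
    exact h

open MeasureTheory intervalIntegral in
/-- Lemma 3.5, `H`-valued form: with `b_H = λ ∫₀^∞ e^{−λt} g(t) dt`, for
every `t ≥ 0` the vector `x_t = ∫₀ᵗ L(s)b_H ds` belongs to `dom(A)` and
`g(t) = λ x_t − A x_t`. Membership `x_t ∈ dom(A)` with `A x_t = v` is expressed by
right-differentiability at `0` of `τ ↦ L(τ)x_t`. -/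
theorem cocycle_laplace_representation
    {H : Type} [NormedAddCommGroup H] [InnerProductSpace ℝ H] [CompleteSpace H]
    [TopologicalSpace.SeparableSpace H]
    -- a C₀-semigroup L with exponential bound
    (L : ℝ → H →L[ℝ] H)
    (hL0 : L 0 = ContinuousLinearMap.id ℝ H)
    (hLsem : ∀ s ≥ (0:ℝ), ∀ t ≥ (0:ℝ), L (s + t) = (L s).comp (L t))
    (hLcont : ∀ x : H, ContinuousOn (fun t => L t x) (Ici 0))
    (M lam₀ : ℝ) (hM : 1 ≤ M) (hlam₀ : 0 < lam₀)
    (hLbound : ∀ t ≥ (0:ℝ), ‖L t‖ ≤ M * Real.exp (lam₀ * t))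
    -- a weakly continuous cocycle g with exponential bound
    (g : ℝ → H) (hg0 : g 0 = 0)
    (hgw : ∀ h : H, ContinuousOn (fun t => ⟪g t, h⟫_ℝ) (Ici 0))
    (hgcoc : ∀ s ≥ (0:ℝ), ∀ t ≥ (0:ℝ), g (t + s) = L t (g s) + g t)
    (C : ℝ) (hgbound : ∀ t ≥ (0:ℝ), ‖g t‖ ≤ C * Real.exp (lam₀ * t))
    -- λ > λ₀ and b_H := λ ∫₀^∞ e^{−λt} g(t) dt
    (lam : ℝ) (hlam : lam₀ < lam) (bH : H)
    (hbH : bH = lam • ∫ t in Ioi (0:ℝ), Real.exp (-lam * t) • g t) :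
    ∀ t ≥ (0:ℝ), ∃ v : H,
      HasDerivWithinAt (fun τ => L τ (∫ s in (0:ℝ)..t, L s bH)) v (Ici 0) 0 ∧
      g t = lam • (∫ s in (0:ℝ)..t, L s bH) - v := by
  intro t ht
  refine ⟨L t bH - bH,
    hasDerivWithinAt_semigroup_integral_orbit hL0 hLsem hLcont bH ht, ?_⟩
  have hlam_pos : 0 < lam := hlam₀.trans hlam
  set R : H := ∫ t in Ioi (0:ℝ), Real.exp (-lam * t) • g t
  -- extend `g` to negative times so that it is weakly continuous on the whole line
  set k : ℝ → H := fun s => g (max s 0) with hk_def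
  have hk_nonneg : ∀ s, 0 ≤ s → k s = g s := fun s hs => by simp [hk_def, max_eq_left hs]
  have hk_meas : StronglyMeasurable k := stronglyMeasurable_of_inner fun h =>
    ((hgw h).comp_continuous (f := fun s : ℝ => max s 0) (by fun_prop)
      (fun s => le_max_right s 0)).stronglyMeasurable
  set φ : ℝ → H := fun s => Real.exp (-lam * s) • k s with hφ_def
  have hexp_meas : StronglyMeasurable fun s : ℝ => Real.exp (-lam * s) :=
    Continuous.stronglyMeasurable (by fun_prop)
  have hφ_meas : StronglyMeasurable φ := hexp_meas.smul hk_meas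
  have hφ_int : IntegrableOn φ (Ioi 0) := by
    refine Integrable.mono'
      ((integrableOn_exp_mul_Ioi (a := lam₀ - lam) (by linarith) 0).const_mul C)
      hφ_meas.aestronglyMeasurable ?_
    refine (ae_restrict_iff' measurableSet_Ioi).2 (Eventually.of_forall fun s hs => ?_)
    have hs' : (0:ℝ) ≤ s := le_of_lt hs
    rw [hφ_def]
    simp only [norm_smul, Real.norm_eq_abs, Real.abs_exp, hk_nonneg s hs']
    calc Real.exp (-lam * s) * ‖g s‖
        ≤ Real.exp (-lam * s) * (C * Real.exp (lam₀ * s)) := by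
          gcongr
          exact hgbound s hs'
      _ = C * (Real.exp (-lam * s) * Real.exp (lam₀ * s)) := by ring
      _ = C * Real.exp ((lam₀ - lam) * s) := by
          rw [← Real.exp_add]
          ring_nf
  have hRφ : R = ∫ s in Ioi (0:ℝ), φ s :=
    setIntegral_congr_fun measurableSet_Ioi fun s hs => by
      simp only [hφ_def, hk_nonneg s (le_of_lt hs)]
  have hexp_int : IntegrableOn (fun s : ℝ => Real.exp (-lam * s)) (Ioi 0) :=
    integrableOn_exp_mul_Ioi (by linarith) 0
  -- the cocycle identity, Laplace transformed
  have hg_eq : ∀ τ, 0 ≤ τ →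
      g τ = (lam * Real.exp (lam * τ)) • (R - ∫ s in (0:ℝ)..τ, φ s) - L τ bH := by
    intro τ hτ
    have htail : R - ∫ s in (0:ℝ)..τ, φ s = ∫ s in Ioi τ, φ s := by
      rw [hRφ, ← integral_Ioi_sub_Ioi hφ_int hτ]
      abel
    have hshift : ∫ s in Ioi τ, φ s = ∫ s in Ioi (0:ℝ), φ (s + τ) := by
      have h := (measurePreserving_add_right volume τ).setIntegral_preimage_emb
        (measurableEmbedding_addRight τ) φ (Ioi τ)
      rw [preimage_add_const_Ioi, sub_self] at h
      exact h.symm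
    have hpoint : ∀ s ∈ Ioi (0:ℝ), φ (s + τ) =
        Real.exp (-lam * τ) • (L τ (φ s) + Real.exp (-lam * s) • g τ) := by
      intro s hs
      have hs' : (0:ℝ) ≤ s := le_of_lt hs
      simp only [hφ_def, hk_nonneg s hs', hk_nonneg (s + τ) (add_nonneg hs' hτ),
        map_smul, ← smul_add, smul_smul, ← Real.exp_add]
      rw [add_comm s τ, hgcoc s hs' τ hτ]
      ring_nf
    have hsplit : ∫ s in Ioi (0:ℝ), φ (s + τ) =
        Real.exp (-lam * τ) • (L τ R + (1 / lam) • g τ) := by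
      rw [setIntegral_congr_fun measurableSet_Ioi hpoint, MeasureTheory.integral_smul,
        MeasureTheory.integral_add ((L τ).integrable_comp hφ_int) (hexp_int.smul_const _),
        (L τ).integral_comp_comm hφ_int, ← hRφ, _root_.integral_smul_const,
        integral_exp_mul_Ioi (by linarith) 0]
      simp
    have hexp : Real.exp (lam * τ) * Real.exp (-lam * τ) = 1 := by
      rw [← Real.exp_add]
      simp
    rw [htail, hshift, hsplit, smul_smul, mul_assoc, hexp, mul_one, smul_add, smul_smul,
      mul_one_div_cancel hlam_pos.ne', one_smul, hbH, map_smul]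
    abel
  -- hence `g` is norm continuous
  have hprim : ContinuousOn (fun τ => ∫ s in (0:ℝ)..τ, φ s) (Ici 0) := by
    intro τ hτ
    have hτ' : (0:ℝ) ≤ τ := hτ
    have h := continuousOn_primitive_interval (a := 0) (b := τ + 1) (f := φ) (μ := volume)
      (by
        rw [uIcc_of_le (by linarith), integrableOn_Icc_iff_integrableOn_Ioc]
        exact hφ_int.mono_set Ioc_subset_Ioi_self)
    rw [uIcc_of_le (by linarith)] at h
    refine (h τ ⟨hτ', by linarith⟩).mono_of_mem_nhdsWithin ?_
    filter_upwards [self_mem_nhdsWithin, mem_nhdsWithin_of_mem_nhds (Iio_mem_nhds (lt_add_one τ))]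
      with u hu hu' using ⟨hu, le_of_lt hu'⟩
  have hk_cont : Continuous k := by
    have hg_cont : ContinuousOn g (Ici 0) := by
      refine ContinuousOn.congr (f := fun τ =>
        (lam * Real.exp (lam * τ)) • (R - ∫ s in (0:ℝ)..τ, φ s) - L τ bH) ?_
        fun τ hτ => hg_eq τ hτ
      exact (ContinuousOn.smul (by fun_prop) (continuousOn_const.sub hprim)).sub (hLcont bH)
    exact hg_cont.comp_continuous (by fun_prop) (fun s => le_max_right s 0)
  have hφ_cont : Continuous φ := by fun_prop
  have hderiv : ∀ τ ∈ uIcc 0 t, HasDerivAt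
      (fun u => Real.exp (lam * u) • (R - ∫ s in (0:ℝ)..u, φ s)) (L τ bH) τ := by
    intro τ hτ
    rw [uIcc_of_le ht] at hτ
    have h1 : HasDerivAt (fun u : ℝ => Real.exp (lam * u)) (Real.exp (lam * τ) * lam) τ := by
      simpa using ((hasDerivAt_id τ).const_mul lam).exp
    have h2 := h1.fun_smul ((hφ_cont.integral_hasStrictDerivAt 0 τ).hasDerivAt.const_sub R)
    refine h2.congr_deriv ?_
    have hexp : Real.exp (lam * τ) * Real.exp (-lam * τ) = 1 := by
      rw [← Real.exp_add]
      simp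
    rw [hφ_def, smul_neg]
    simp only [smul_smul, hexp, one_smul, hk_nonneg τ hτ.1]
    rw [hg_eq τ hτ.1, mul_comm lam]
    abel
  have hL_int : IntervalIntegrable (fun s => L s bH) volume 0 t :=
    ((hLcont bH).mono (by rw [uIcc_of_le ht]; exact Icc_subset_Ici_self)).intervalIntegrable
  have hftc := integral_eq_sub_of_hasDerivAt hderiv hL_int
  simp only [mul_zero, Real.exp_zero, one_smul, integral_same, sub_zero] at hftc
  rw [hftc, hg_eq t ht, smul_sub lam, smul_smul, ← hbH]
  abel
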